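/- Let G be a discrete group with a length function |·| such that the pair (G, |·|) has property (J). Then there exists a constant M > 0, depending only on (G, |·|), such that for every complex Hilbert space H, every norm-closed self-adjoint subalgebra A of B(H), every action α of G on A by *-automorphisms, and every finitely supported X : G → A, one has ‖T_X‖ ≤ M ( Σ_{g∈G} (1+|g|)⁴ ‖X(g)‖² )^{1/2}. -/

import Mathlib

/-- A length function on a group `G`. -/
structure IsLengthFunction {G : Type*} [Group G] (ℓ : G → ℝ) : Prop where
  nonneg : ∀ g, 0 ≤ ℓ g
  one : ℓ 1 = 0
  inv : ∀ g, ℓ g⁻¹ = ℓ g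
  subadd : ∀ g h, ℓ (g * h) ≤ ℓ g + ℓ h

/-- The set `C_{t,δ} = {g : t − δ ≤ |g| ≤ t + δ}`. -/
def CJ {G : Type*} (ℓ : G → ℝ) (t δ : ℝ) : Set G := {g | t - δ ≤ ℓ g ∧ ℓ g ≤ t + δ}

/-- Property (J) for a group with a length function. -/
def HasPropertyJ {G : Type*} [Group G] (ℓ : G → ℝ) : Prop :=
  ∃ a b c : ℝ, 0 < a ∧ 0 < b ∧ 0 < c ∧
    ∃ u : G → ℝ → G,
      (∀ g : G, ∀ s : ℝ, 0 ≤ s → s < ℓ g + 1 →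
        u g s ∈ CJ ℓ s a ∧ (u g s)⁻¹ * g ∈ CJ ℓ (ℓ g + 1 - s) b) ∧
      (∀ (p : ℕ) (x y : G),
        (2 * (p : ℝ) ≤ ℓ x + ℓ y - ℓ (x * y) ∧
          ℓ x + ℓ y - ℓ (x * y) < 2 * (p : ℝ) + 2) →
        (u (x * y) (ℓ x - p))⁻¹ * x ∈ CJ ℓ p c) ∧
      (∀ μ ν : ℝ, 0 < μ → 0 < ν → ∃ N : ℕ, ∀ (y : G) (p : ℕ), (p : ℝ) ≤ ℓ y →
        {cv : G × G | cv.1 ∈ CJ ℓ p μ ∧ cv.2 ∈ CJ ℓ (ℓ y - p) ν ∧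
            cv.1⁻¹ * cv.2 = y}.Finite ∧
        {cv : G × G | cv.1 ∈ CJ ℓ p μ ∧ cv.2 ∈ CJ ℓ (ℓ y - p) ν ∧
            cv.1⁻¹ * cv.2 = y}.ncard ≤ N)


open scoped ENNReal in
/-- Cauchy–Schwarz for sums in `ℝ≥0∞`. -/
theorem ENNReal.tsum_mul_sq_le {ι : Type*} (f g : ι → ℝ≥0∞) :
    (∑' i, f i * g i) ^ 2 ≤ (∑' i, f i ^ 2) * ∑' i, g i ^ 2 := by
  let _ : MeasurableSpace ι := ⊤
  have h := ENNReal.lintegral_mul_le_Lp_mul_Lq (MeasureTheory.Measure.count (α := ι))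
    Real.HolderConjugate.two_two (f := f) (g := g)
    (measurable_from_top.aemeasurable) (measurable_from_top.aemeasurable)
  simp only [MeasureTheory.lintegral_count, Pi.mul_apply, ENNReal.rpow_two] at h
  calc _ ≤ _ := pow_le_pow_left' h 2
    _ = _ := by
      rw [mul_pow, ← ENNReal.rpow_two, ← ENNReal.rpow_two, ← ENNReal.rpow_mul,
        ← ENNReal.rpow_mul]
      norm_num

namespace LengthFunction

open scoped ENNReal

variable {G : Type*}

open Classical in
/-- The indicator function of `{g : |ℓ g - t| ≤ R}`. -/
noncomputable def shell (ℓ : G → ℝ) (R t : ℝ) (g : G) : ℝ≥0∞ := if |ℓ g - t| ≤ R then 1 else 0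

theorem shell_sq (ℓ : G → ℝ) (R t : ℝ) (g : G) : shell ℓ R t g ^ 2 = shell ℓ R t g := by
  unfold shell; split_ifs <;> simp

theorem shell_of_le {ℓ : G → ℝ} {R t : ℝ} {g : G} (h : |ℓ g - t| ≤ R) : shell ℓ R t g = 1 :=
  if_pos h

open Classical in
/-- The part of `f` supported on `{g : k - 1 < ℓ g ≤ k}`. -/
noncomputable def layer (ℓ : G → ℝ) (f : G → ℝ≥0∞) (k : ℕ) (g : G) : ℝ≥0∞ :=
  if k = ⌈ℓ g⌉₊ then f g else 0

theorem tsum_layer (ℓ : G → ℝ) (f : G → ℝ≥0∞) (g : G) : ∑' k, layer ℓ f k g = f g := by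
  simp [layer, tsum_ite_eq]

theorem layer_ne_zero {ℓ : G → ℝ} {f : G → ℝ≥0∞} {k : ℕ} {g : G} (h : layer ℓ f k g ≠ 0) :
    k = ⌈ℓ g⌉₊ := by
  by_contra hk
  exact h (if_neg hk)

theorem abs_sub_natCeil_le {r : ℝ} (hr : 0 ≤ r) : |r - ⌈r⌉₊| ≤ 1 := by
  rw [abs_le]
  constructor <;> linarith [Nat.le_ceil r, Nat.ceil_lt_add_one hr]

theorem tsum_mul_tsum_layer_sq (ℓ : G → ℝ) (f : G → ℝ≥0∞) (φ : ℕ → ℝ≥0∞) :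
    ∑' k, φ k * ∑' x, layer ℓ f k x ^ 2 = ∑' x, φ ⌈ℓ x⌉₊ * f x ^ 2 := by
  simp only [← ENNReal.tsum_mul_left]
  rw [ENNReal.tsum_comm]
  refine tsum_congr fun x => ?_
  rw [tsum_eq_single ⌈ℓ x⌉₊]
  · simp [layer]
  · intro k hk
    simp [layer, hk]

/-- The indicator function of `|l - m| ≤ k`. -/
noncomputable def near (k l m : ℕ) : ℝ≥0∞ := if l ≤ m + k ∧ m ≤ l + k then 1 else 0

theorem near_sq (k l m : ℕ) : near k l m ^ 2 = near k l m := by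
  unfold near; split_ifs <;> simp

theorem near_comm (k l m : ℕ) : near k l m = near k m l := by
  unfold near; simp only [and_comm]

theorem tsum_near_le (k m : ℕ) : ∑' l, near k l m ≤ 2 * (k + 1) := by
  rw [tsum_eq_sum (s := Finset.Icc (m - k) (m + k))]
  · calc _ ≤ ∑ l ∈ Finset.Icc (m - k) (m + k), (1 : ℝ≥0∞) :=
          Finset.sum_le_sum fun l _ => by unfold near; split_ifs <;> simp
      _ ≤ _ := by
          rw [Finset.sum_const, Nat.card_Icc, nsmul_one]
          exact_mod_cast (by omega : m + k + 1 - (m - k) ≤ 2 * (k + 1))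
  · intro l hl
    refine if_neg fun h => hl ?_
    rw [Finset.mem_Icc]
    omega

variable [Group G]

/-- A product `z = x * y` has an approximate centre: the tripod spanned by `1`, `x`, `z` has a
branch point `w`, up to a uniform error. -/
theorem exists_center {ℓ : G → ℝ} (hℓ : IsLengthFunction ℓ) (hJ : HasPropertyJ ℓ) :
    ∃ R : ℝ, ∀ (x y z : G) (k l m : ℝ), x * y = z → |ℓ x - k| ≤ 1 → |ℓ y - l| ≤ 1 →
      |ℓ z - m| ≤ 1 → ∃ w, |ℓ w - (k + m - l) / 2| ≤ R ∧ |ℓ (w⁻¹ * x) - (k + l - m) / 2| ≤ R ∧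
        |ℓ (w⁻¹ * z) - (m + l - k) / 2| ≤ R := by
  obtain ⟨a, b, c, ha, hb, hc, u, hu, hcan, -⟩ := hJ
  refine ⟨a + b + c + 10, ?_⟩
  rintro x y _ k l m rfl hx hy hz
  have hD : 0 ≤ (ℓ x + ℓ y - ℓ (x * y)) / 2 := by linarith [hℓ.subadd x y]
  set p := ⌊(ℓ x + ℓ y - ℓ (x * y)) / 2⌋₊
  have hp1 := Nat.floor_le hD
  have hp2 := Nat.lt_floor_add_one ((ℓ x + ℓ y - ℓ (x * y)) / 2)
  change (p : ℝ) ≤ _ at hp1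
  change _ < (p : ℝ) + 1 at hp2
  have hxz : ℓ y ≤ ℓ x + ℓ (x * y) := by
    have := hℓ.subadd x⁻¹ (x * y)
    rwa [inv_mul_cancel_left, hℓ.inv] at this
  have hzy : ℓ x ≤ ℓ (x * y) + ℓ y := by
    have := hℓ.subadd (x * y) y⁻¹
    rwa [mul_inv_cancel_right, hℓ.inv] at this
  obtain ⟨⟨h1, h2⟩, h3, h4⟩ := hu (x * y) (ℓ x - p) (by linarith) (by linarith)
  obtain ⟨h5, h6⟩ := hcan p x y ⟨by linarith, by linarith⟩
  rw [abs_le] at hx hy hz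
  refine ⟨u (x * y) (ℓ x - p), ?_, ?_, ?_⟩ <;> rw [abs_le] <;> constructor <;> linarith

/-- The number of decompositions of `g` into factors of prescribed approximate lengths, adding up
to the length of `g`, is uniformly bounded. -/
theorem exists_tsum_shell_le {ℓ : G → ℝ} (hℓ : IsLengthFunction ℓ) (hJ : HasPropertyJ ℓ) (R : ℝ) :
    ∃ N : ℕ, ∀ (g : G) (s t : ℝ), |ℓ g - (s + t)| ≤ 1 →
      ∑' w, shell ℓ R s w * shell ℓ R t (w⁻¹ * g) ≤ N := by
  obtain ⟨-, -, -, -, -, -, -, -, -, hfin⟩ := hJ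
  obtain ⟨N, hN⟩ := hfin (2 * |R| + 5) (2 * |R| + 5) (by positivity) (by positivity)
  refine ⟨N, fun g s t hst => ?_⟩
  set q := ⌊min (max s 0) (ℓ g)⌋₊
  have hmin : 0 ≤ min (max s 0) (ℓ g) := le_min (le_max_right _ _) (hℓ.nonneg g)
  have hq1 : (q : ℝ) ≤ min (max s 0) (ℓ g) := Nat.floor_le hmin
  have hq2 : min (max s 0) (ℓ g) < (q : ℝ) + 1 := Nat.lt_floor_add_one _
  obtain ⟨hF, hcard⟩ := hN g q (hq1.trans (min_le_right _ _))
  set F := {cv : G × G | cv.1 ∈ CJ ℓ q (2 * |R| + 5) ∧ cv.2 ∈ CJ ℓ (ℓ g - q) (2 * |R| + 5) ∧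
            cv.1⁻¹ * cv.2 = g}
  set S := {w : G | |ℓ w - s| ≤ R ∧ |ℓ (w⁻¹ * g) - t| ≤ R}
  have hmaps : Set.MapsTo (fun w : G => (w⁻¹, w⁻¹ * g)) S F := by
    rintro w ⟨h1, h2⟩
    have hw := hℓ.nonneg w
    have hw' := hℓ.nonneg (w⁻¹ * g)
    rw [abs_le] at h1 h2 hst
    have hR := le_abs_self R
    have hqs : |(q : ℝ) - s| ≤ |R| + 2 := by
      rw [abs_le]
      rcases min_cases (max s 0) (ℓ g) with ⟨h, _⟩ | ⟨h, _⟩ <;>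
      rcases max_cases s 0 with ⟨h', _⟩ | ⟨h', _⟩ <;> rw [h] at hq1 hq2 <;>
      first
        | (rw [h'] at hq1 hq2; constructor <;> linarith)
        | (constructor <;> linarith)
    rw [abs_le] at hqs
    refine ⟨⟨?_, ?_⟩, ⟨?_, ?_⟩, ?_⟩ <;> simp only [hℓ.inv, inv_inv, mul_inv_cancel_left] <;>
      linarith
  have hinj : Set.InjOn (fun w : G => (w⁻¹, w⁻¹ * g)) S := by
    intro w _ w' _ h
    simpa using congrArg Prod.fst h
  calc ∑' w, shell ℓ R s w * shell ℓ R t (w⁻¹ * g) = ∑' w, S.indicator 1 w := by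
        refine tsum_congr fun w => ?_
        by_cases h1 : |ℓ w - s| ≤ R <;> by_cases h2 : |ℓ (w⁻¹ * g) - t| ≤ R <;>
          simp [shell, Set.indicator, S, h1, h2]
    _ = (S.encard : ℝ≥0∞) := by
        rw [← tsum_subtype]
        simp
    _ ≤ (F.encard : ℝ≥0∞) := by
        exact_mod_cast Set.encard_le_encard_of_injOn hmaps hinj
    _ ≤ N := by
        rw [← hF.cast_ncard_eq]
        exact_mod_cast hcard

/-- The convolution of two `ℝ≥0∞`-valued functions. -/
noncomputable def conv (f η : G → ℝ≥0∞) (z : G) : ℝ≥0∞ := ∑' x, f x * η (x⁻¹ * z)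

theorem tsum_mul_left_inv_mul (f : G → ℝ≥0∞) (w : G) : ∑' x, f (w⁻¹ * x) = ∑' x, f x :=
  (Equiv.mulLeft w⁻¹).tsum_eq f

/-- The estimate of `f * η` on a shell, for `f` and `η` supported on shells. -/
theorem tsum_shell_mul_conv_sq_le {ℓ : G → ℝ} {R : ℝ} {N : ℝ≥0∞} {k l m : ℝ}
    (hc : ∀ (x y z : G), x * y = z → |ℓ x - k| ≤ 1 → |ℓ y - l| ≤ 1 →
      |ℓ z - m| ≤ 1 → ∃ w, |ℓ w - (k + m - l) / 2| ≤ R ∧ |ℓ (w⁻¹ * x) - (k + l - m) / 2| ≤ R ∧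
        |ℓ (w⁻¹ * z) - (m + l - k) / 2| ≤ R)
    (hinv : ∀ g, ℓ g⁻¹ = ℓ g)
    (hN : ∀ (g : G) (s t : ℝ), |ℓ g - (s + t)| ≤ 1 →
      ∑' w, shell ℓ R s w * shell ℓ R t (w⁻¹ * g) ≤ N)
    (f η : G → ℝ≥0∞) (hf : ∀ x, f x ≠ 0 → |ℓ x - k| ≤ 1) (hη : ∀ y, η y ≠ 0 → |ℓ y - l| ≤ 1) :
    ∑' z, shell ℓ 1 m z * conv f η z ^ 2 ≤ N ^ 3 * (∑' x, f x ^ 2) * ∑' y, η y ^ 2 := by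
  set A := shell ℓ R ((k + m - l) / 2)
  set B := shell ℓ R ((k + l - m) / 2)
  set C := shell ℓ R ((m + l - k) / 2)
  set F : G → ℝ≥0∞ := fun w => ∑' c, B c * f (w * c) ^ 2
  set E : G → ℝ≥0∞ := fun v => ∑' c, B c * η (c⁻¹ * v) ^ 2
  have hBinv : ∀ c, B c⁻¹ = B c := fun c => by simp only [B, shell, hinv]
  have hF : ∑' w, A w * F w ≤ N * ∑' x, f x ^ 2 := by
    calc ∑' w, A w * F w = ∑' w, ∑' x, A w * B (w⁻¹ * x) * f x ^ 2 := by
          refine tsum_congr fun w => ?_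
          rw [← ENNReal.tsum_mul_left,
            ← tsum_mul_left_inv_mul (fun c => A w * (B c * f (w * c) ^ 2)) w]
          simp only [mul_inv_cancel_left, mul_assoc]
      _ = ∑' x, (∑' w, A w * B (w⁻¹ * x)) * f x ^ 2 := by
          rw [ENNReal.tsum_comm]
          simp only [ENNReal.tsum_mul_right]
      _ ≤ ∑' x, N * f x ^ 2 := by
          refine ENNReal.tsum_le_tsum fun x => ?_
          by_cases hx : f x = 0
          · simp [hx]
          · gcongr
            refine hN x _ _ ?_
            convert hf x hx using 2
            ring
      _ = _ := ENNReal.tsum_mul_left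
  have hE : ∑' v, C v * E v ≤ N * ∑' y, η y ^ 2 := by
    calc ∑' v, C v * E v = ∑' c, ∑' v, C v * (B c * η (c⁻¹ * v) ^ 2) := by
          simp only [E, ← ENNReal.tsum_mul_left]
          exact ENNReal.tsum_comm
      _ = ∑' c, ∑' y, B c * C (c⁻¹ * y) * η y ^ 2 := by
          rw [← (Equiv.inv G).tsum_eq]
          refine tsum_congr fun c => ?_
          rw [← tsum_mul_left_inv_mul _ c]
          refine tsum_congr fun y => ?_
          simp only [Equiv.inv_apply, hBinv, inv_inv, mul_inv_cancel_left]
          ring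
      _ = ∑' y, (∑' c, B c * C (c⁻¹ * y)) * η y ^ 2 := by
          rw [ENNReal.tsum_comm]
          simp only [ENNReal.tsum_mul_right]
      _ ≤ ∑' y, N * η y ^ 2 := by
          refine ENNReal.tsum_le_tsum fun y => ?_
          by_cases hy : η y = 0
          · simp [hy]
          · gcongr
            refine hN y _ _ ?_
            convert hη y hy using 2
            ring
      _ = _ := ENNReal.tsum_mul_left
  have hpt : ∀ z, shell ℓ 1 m z * conv f η z ^ 2 ≤
      N * ∑' w, A w * F w * (C (w⁻¹ * z) * E (w⁻¹ * z)) := by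
    intro z
    by_cases hz : |ℓ z - m| ≤ 1
    swap
    · simp [shell, hz]
    rw [shell_of_le hz, one_mul]
    have h1 : conv f η z ≤
        ∑' w, A w * C (w⁻¹ * z) * ∑' c, B c * (f (w * c) * η (c⁻¹ * (w⁻¹ * z))) := by
      calc conv f η z ≤ ∑' x, ∑' w, A w * C (w⁻¹ * z) * (B (w⁻¹ * x) * (f x * η (x⁻¹ * z))) := by
            refine ENNReal.tsum_le_tsum fun x => ?_
            by_cases hx : f x = 0
            · simp [hx]
            by_cases hy : η (x⁻¹ * z) = 0
            · simp [hy]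
            obtain ⟨w, h1, h2, h3⟩ := hc x (x⁻¹ * z) z (by simp) (hf _ hx) (hη _ hy) hz
            refine le_trans ?_ (ENNReal.le_tsum w)
            simp [A, B, C, shell_of_le h1, shell_of_le h2, shell_of_le h3]
        _ = _ := by
            rw [ENNReal.tsum_comm]
            refine tsum_congr fun w => ?_
            rw [← ENNReal.tsum_mul_left, ← tsum_mul_left_inv_mul (fun c =>
              A w * C (w⁻¹ * z) * (B c * (f (w * c) * η (c⁻¹ * (w⁻¹ * z))))) w]
            refine tsum_congr fun x => ?_
            simp [mul_assoc]
    have h2 : ∀ w, (∑' c, B c * (f (w * c) * η (c⁻¹ * (w⁻¹ * z)))) ^ 2 ≤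
        F w * E (w⁻¹ * z) := by
      intro w
      have := ENNReal.tsum_mul_sq_le (fun c => B c * f (w * c))
        (fun c => B c * η (c⁻¹ * (w⁻¹ * z)))
      simp only [mul_pow, B, shell_sq] at this
      refine le_trans (le_of_eq ?_) this
      congr 1
      refine tsum_congr fun c => ?_
      rw [mul_mul_mul_comm, ← sq, shell_sq]
    calc conv f η z ^ 2 ≤ _ := pow_le_pow_left' h1 2
      _ = (∑' w, (A w * C (w⁻¹ * z)) * (A w * C (w⁻¹ * z) *
            ∑' c, B c * (f (w * c) * η (c⁻¹ * (w⁻¹ * z))))) ^ 2 := by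
          congr 1
          refine tsum_congr fun w => ?_
          rw [← mul_assoc, ← sq, mul_pow, shell_sq, shell_sq]
      _ ≤ _ := ENNReal.tsum_mul_sq_le _ _
      _ ≤ _ := by
          simp only [mul_pow, A, C, shell_sq]
          refine mul_le_mul' ?_ (ENNReal.tsum_le_tsum fun w => ?_)
          · refine hN z _ _ ?_
            convert hz using 2
            ring
          · calc _ ≤ _ := mul_le_mul_right (h2 w) _
              _ = _ := by ring
  calc ∑' z, shell ℓ 1 m z * conv f η z ^ 2
      ≤ ∑' z, N * ∑' w, A w * F w * (C (w⁻¹ * z) * E (w⁻¹ * z)) := ENNReal.tsum_le_tsum hpt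
    _ = N * ∑' w, A w * F w * ∑' z, C (w⁻¹ * z) * E (w⁻¹ * z) := by
        rw [ENNReal.tsum_mul_left, ENNReal.tsum_comm]
        simp only [ENNReal.tsum_mul_left]
    _ = N * ((∑' w, A w * F w) * ∑' v, C v * E v) := by
        simp only [tsum_mul_left_inv_mul (fun v => C v * E v), ENNReal.tsum_mul_right]
    _ ≤ N * ((N * ∑' x, f x ^ 2) * (N * ∑' y, η y ^ 2)) := by gcongr
    _ = _ := by ring

theorem conv_layer_le {ℓ : G → ℝ} (hℓ : IsLengthFunction ℓ) (f η : G → ℝ≥0∞) (k l : ℕ) (z : G) :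
    conv (layer ℓ f k) (layer ℓ η l) z ≤
      near k l ⌈ℓ z⌉₊ * conv (layer ℓ f k) (layer ℓ η l) z := by
  unfold conv
  rw [← ENNReal.tsum_mul_left]
  refine ENNReal.tsum_le_tsum fun x => ?_
  by_cases hx : layer ℓ f k x = 0
  · simp [hx]
  by_cases hy : layer ℓ η l (x⁻¹ * z) = 0
  · simp [hy]
  have h1 : ℓ (x⁻¹ * z) ≤ ℓ x + ℓ z := by simpa [hℓ.inv] using hℓ.subadd x⁻¹ z
  have h2 : ℓ z ≤ ℓ x + ℓ (x⁻¹ * z) := by simpa using hℓ.subadd x (x⁻¹ * z)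
  have hk := layer_ne_zero hx
  have hl := layer_ne_zero hy
  rw [near, if_pos, one_mul]
  constructor
  · rw [hl, hk, Nat.ceil_le, Nat.cast_add]
    linarith [Nat.le_ceil (ℓ x), Nat.le_ceil (ℓ z)]
  · rw [hl, hk, Nat.ceil_le, Nat.cast_add]
    linarith [Nat.le_ceil (ℓ x), Nat.le_ceil (ℓ (x⁻¹ * z))]

theorem conv_le_tsum_layer {ℓ : G → ℝ} (hℓ : IsLengthFunction ℓ) (f η : G → ℝ≥0∞) (z : G) :
    conv f η z ≤
      ∑' k, ∑' l, near k l ⌈ℓ z⌉₊ * conv (layer ℓ f k) (layer ℓ η l) z := by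
  calc conv f η z = ∑' x, ∑' k, ∑' l, layer ℓ f k x * layer ℓ η l (x⁻¹ * z) := by
        refine tsum_congr fun x => ?_
        simp only [ENNReal.tsum_mul_left, ENNReal.tsum_mul_right, tsum_layer]
    _ = ∑' k, ∑' l, conv (layer ℓ f k) (layer ℓ η l) z := by
        rw [ENNReal.tsum_comm]
        exact tsum_congr fun k => ENNReal.tsum_comm
    _ ≤ _ := ENNReal.tsum_le_tsum fun k => ENNReal.tsum_le_tsum fun l =>
        conv_layer_le hℓ f η k l z

theorem tsum_inv_sq_ne_top : ∑' k : ℕ, ((k + 1 : ℝ≥0∞)⁻¹) ^ 2 ≠ ∞ := by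
  have h : Summable fun k : ℕ => 1 / ((k : ℝ) + 1) ^ 2 := by
    simpa using (summable_nat_add_iff 1).2 (Real.summable_one_div_nat_pow.2 one_lt_two)
  convert h.tsum_ofReal_ne_top using 3 with k
  rw [one_div, ENNReal.ofReal_inv_of_pos (by positivity), ENNReal.ofReal_pow (by positivity),
    ENNReal.ofReal_add (by positivity) zero_le_one, ENNReal.ofReal_natCast, ENNReal.ofReal_one,
    ENNReal.inv_pow]

/-- Property (J) implies property (RD), with exponent `2`, for convolution operators. -/
theorem exists_tsum_conv_sq_le {ℓ : G → ℝ} (hℓ : IsLengthFunction ℓ) (hJ : HasPropertyJ ℓ) :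
    ∃ C : ℝ≥0∞, C ≠ ∞ ∧ ∀ f η : G → ℝ≥0∞, ∑' z, conv f η z ^ 2 ≤
      C * (∑' x, ENNReal.ofReal (1 + ℓ x) ^ 4 * f x ^ 2) * ∑' y, η y ^ 2 := by
  obtain ⟨R, hR⟩ := exists_center hℓ hJ
  obtain ⟨N, hN⟩ := exists_tsum_shell_le hℓ hJ R
  set Z := ∑' k : ℕ, ((k + 1 : ℝ≥0∞)⁻¹) ^ 2
  refine ⟨4 * Z * N ^ 3 * 2 ^ 4, by finiteness [tsum_inv_sq_ne_top], fun f η => ?_⟩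
  have hblock (k l : ℕ) : ∑' z, near k l ⌈ℓ z⌉₊ * conv (layer ℓ f k) (layer ℓ η l) z ^ 2 ≤
      2 * (k + 1) * (N ^ 3 * (∑' x, layer ℓ f k x ^ 2) * ∑' y, layer ℓ η l y ^ 2) := by
    calc _ ≤ ∑' z, ∑' m : ℕ, near k l m *
          (shell ℓ 1 m z * conv (layer ℓ f k) (layer ℓ η l) z ^ 2) := by
          refine ENNReal.tsum_le_tsum fun z => le_trans ?_ (ENNReal.le_tsum ⌈ℓ z⌉₊)
          rw [shell_of_le (abs_sub_natCeil_le (hℓ.nonneg z)), one_mul]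
      _ = ∑' m : ℕ, near k l m *
          ∑' z, shell ℓ 1 m z * conv (layer ℓ f k) (layer ℓ η l) z ^ 2 := by
          rw [ENNReal.tsum_comm]
          simp only [ENNReal.tsum_mul_left]
      _ ≤ ∑' m : ℕ, near k l m *
          (N ^ 3 * (∑' x, layer ℓ f k x ^ 2) * ∑' y, layer ℓ η l y ^ 2) := by
          refine ENNReal.tsum_le_tsum fun m => mul_le_mul_right ?_ _
          refine tsum_shell_mul_conv_sq_le (k := k) (l := l) (fun x y z => hR x y z k l m)
            hℓ.inv hN _ _ (fun x hx => ?_) (fun y hy => ?_)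
          · rw [layer_ne_zero hx]
            exact abs_sub_natCeil_le (hℓ.nonneg x)
          · rw [layer_ne_zero hy]
            exact abs_sub_natCeil_le (hℓ.nonneg y)
      _ ≤ _ := by
          rw [ENNReal.tsum_mul_right]
          gcongr
          simp only [near_comm k l]
          exact tsum_near_le k l
  have hpt (z : G) : conv f η z ^ 2 ≤ Z * ∑' k : ℕ, (k + 1) ^ 2 * (2 * (k + 1) *
      ∑' l, near k l ⌈ℓ z⌉₊ * conv (layer ℓ f k) (layer ℓ η l) z ^ 2) := by
    calc conv f η z ^ 2 ≤ _ := pow_le_pow_left' (conv_le_tsum_layer hℓ f η z) 2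
      _ = (∑' k : ℕ, (k + 1 : ℝ≥0∞)⁻¹ * ((k + 1) *
            ∑' l, near k l ⌈ℓ z⌉₊ * conv (layer ℓ f k) (layer ℓ η l) z)) ^ 2 := by
          congr 1
          refine tsum_congr fun k => ?_
          rw [← mul_assoc, ENNReal.inv_mul_cancel (by simp) (by finiteness), one_mul]
      _ ≤ _ := ENNReal.tsum_mul_sq_le _ _
      _ ≤ _ := by
          refine mul_le_mul_right (ENNReal.tsum_le_tsum fun k => ?_) _
          rw [mul_pow]
          refine mul_le_mul_right ?_ _
          calc _ = (∑' l, near k l ⌈ℓ z⌉₊ *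
                (near k l ⌈ℓ z⌉₊ * conv (layer ℓ f k) (layer ℓ η l) z)) ^ 2 := by
                simp only [← mul_assoc, ← sq, near_sq]
            _ ≤ _ := ENNReal.tsum_mul_sq_le _ _
            _ ≤ _ := by
                simp only [mul_pow, near_sq]
                exact mul_le_mul_left (tsum_near_le _ _) _
  calc ∑' z, conv f η z ^ 2 ≤ _ := ENNReal.tsum_le_tsum hpt
    _ = Z * ∑' k : ℕ, (k + 1 : ℝ≥0∞) ^ 2 * (2 * (k + 1) * ∑' l, ∑' z,
          near k l ⌈ℓ z⌉₊ * conv (layer ℓ f k) (layer ℓ η l) z ^ 2) := by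
        rw [ENNReal.tsum_mul_left, ENNReal.tsum_comm]
        simp only [ENNReal.tsum_mul_left]
        congr 1
        refine tsum_congr fun k => ?_
        rw [ENNReal.tsum_comm]
    _ ≤ Z * ∑' k : ℕ, (k + 1 : ℝ≥0∞) ^ 2 * (2 * (k + 1) * ∑' l,
          2 * (k + 1) * (N ^ 3 * (∑' x, layer ℓ f k x ^ 2) * ∑' y, layer ℓ η l y ^ 2)) := by
        gcongr with k l
        exact hblock k l
    _ = Z * ∑' k : ℕ, (4 * N ^ 3 * ∑' y, η y ^ 2) *
          ((k + 1 : ℝ≥0∞) ^ 4 * ∑' x, layer ℓ f k x ^ 2) := by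
        have hη : ∑' l, ∑' y, layer ℓ η l y ^ 2 = ∑' y, η y ^ 2 := by
          simpa using tsum_mul_tsum_layer_sq ℓ η fun _ => 1
        simp only [ENNReal.tsum_mul_left, hη]
        rw [← ENNReal.tsum_mul_left (a := 4 * N ^ 3 * ∑' y, η y ^ 2)]
        congr 1
        refine tsum_congr fun k => ?_
        ring
    _ = 4 * Z * N ^ 3 * (∑' x, (⌈ℓ x⌉₊ + 1 : ℝ≥0∞) ^ 4 * f x ^ 2) * ∑' y, η y ^ 2 := by
        rw [ENNReal.tsum_mul_left, tsum_mul_tsum_layer_sq ℓ f fun k => (k + 1 : ℝ≥0∞) ^ 4]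
        ring
    _ ≤ 4 * Z * N ^ 3 * (∑' x, 2 ^ 4 * (ENNReal.ofReal (1 + ℓ x) ^ 4 * f x ^ 2)) *
          ∑' y, η y ^ 2 := by
        refine mul_le_mul_left (mul_le_mul_right (ENNReal.tsum_le_tsum fun x => ?_) _) _
        rw [← mul_assoc, ← mul_pow]
        gcongr
        rw [show (2 : ℝ≥0∞) = ENNReal.ofReal 2 by simp, ← ENNReal.ofReal_mul (by norm_num),
          show (⌈ℓ x⌉₊ + 1 : ℝ≥0∞) = ENNReal.ofReal (⌈ℓ x⌉₊ + 1) by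
            rw [ENNReal.ofReal_add (by positivity) zero_le_one]; simp]
        refine ENNReal.ofReal_le_ofReal ?_
        linarith [Nat.ceil_lt_add_one (hℓ.nonneg x), hℓ.nonneg x]
    _ = _ := by
        rw [ENNReal.tsum_mul_left]
        ring

end LengthFunction

theorem lp.tsum_enorm_sq {ι : Type*} {E : ι → Type*} [∀ i, NormedAddCommGroup (E i)]
    (ξ : lp E 2) : ∑' i, ‖ξ i‖ₑ ^ 2 = ‖ξ‖ₑ ^ 2 := by
  have h := lp.hasSum_norm (by norm_num) ξ
  simp only [ENNReal.toReal_ofNat, Real.rpow_two] at h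
  rw [← ofReal_norm, ← ENNReal.ofReal_pow (norm_nonneg _), ← h.tsum_eq,
    ENNReal.ofReal_tsum_of_nonneg (fun i => by positivity) h.summable]
  refine tsum_congr fun i => ?_
  rw [← ofReal_norm, ENNReal.ofReal_pow (norm_nonneg _)]

/-- If `(G,|·|)` has property (J), there is `M > 0` such that for any action of `G` by
*-automorphisms on a norm-closed self-adjoint subalgebra `A ⊆ B(H)` and any finitely supported
`X : G → A`, the operator `T_X` on `ℓ²(G,H)` (representing `Σ_g L_g X(g)` in
`C*_r(A ⋊_α G)`) satisfies `‖T_X‖ ≤ M (Σ_g (1+|g|)⁴ ‖X(g)‖²)^{1/2}`. -/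
theorem propertyJ_complete_scalar_rapid_decay {G : Type*} [Group G] (ℓ : G → ℝ)
    (hℓ : IsLengthFunction ℓ) (hJ : HasPropertyJ ℓ) :
    ∃ M : ℝ, 0 < M ∧
      ∀ (H : Type*) [NormedAddCommGroup H] [InnerProductSpace ℂ H] [CompleteSpace H]
        (A : NonUnitalStarSubalgebra ℂ (H →L[ℂ] H)),
        IsClosed (A : Set (H →L[ℂ] H)) →
      ∀ α : G → (A ≃⋆ₐ[ℂ] A), (∀ x, α 1 x = x) →
        (∀ g h x, α (g * h) x = α g (α h x)) →
      ∀ (X : G →₀ A) (T : lp (fun _ : G => H) 2 →L[ℂ] lp (fun _ : G => H) 2),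
        (∀ (ξ : lp (fun _ : G => H) 2) (h : G),
          (T ξ : ∀ _ : G, H) h = ∑ g ∈ X.support,
            ((α (h⁻¹ * g) (X g) : H →L[ℂ] H) ((ξ : ∀ _ : G, H) (g⁻¹ * h)))) →
        ‖T‖ ≤ M * Real.sqrt (∑ g ∈ X.support,
            (1 + ℓ g) ^ 4 * ‖(X g : H →L[ℂ] H)‖ ^ 2) := by
 
  obtain ⟨C, hC, hconv⟩ := LengthFunction.exists_tsum_conv_sq_le hℓ hJ
  refine ⟨√C.toReal + 1, by positivity, ?_⟩
  intro H _ _ _ A hA α _ _ X T hT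
  have hα (g : G) (x : A) : ‖(α g x : H →L[ℂ] H)‖ = ‖(x : H →L[ℂ] H)‖ :=
    have : IsClosed (A : Set (H →L[ℂ] H)) := hA
    NonUnitalStarAlgHom.norm_map (α g) (α g).injective x
  set S := ∑ g ∈ X.support, (1 + ℓ g) ^ 4 * ‖(X g : H →L[ℂ] H)‖ ^ 2
  have hS : 0 ≤ S := Finset.sum_nonneg fun g _ => by have := hℓ.nonneg g; positivity
  refine T.opNorm_le_bound (by positivity) fun ξ => ?_
  set f : G → ENNReal := fun g => ‖(X g : H →L[ℂ] H)‖ₑ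
  have hf : ∑' x, ENNReal.ofReal (1 + ℓ x) ^ 4 * f x ^ 2 = ENNReal.ofReal S := by
    rw [tsum_eq_sum (s := X.support) fun g hg => by simp [f, Finsupp.notMem_support_iff.1 hg],
      ENNReal.ofReal_sum_of_nonneg fun g _ => by have := hℓ.nonneg g; positivity]
    refine Finset.sum_congr rfl fun g _ => ?_
    have := hℓ.nonneg g
    rw [ENNReal.ofReal_mul (by positivity), ENNReal.ofReal_pow (by positivity),
      ENNReal.ofReal_pow (by positivity), ofReal_norm]
  have hpt (h : G) : ‖T ξ h‖ₑ ≤ LengthFunction.conv f (fun k => ‖ξ k‖ₑ) h := by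
    rw [hT]
    calc _ ≤ ∑ g ∈ X.support, f g * ‖ξ (g⁻¹ * h)‖ₑ := by
          refine (enorm_sum_le _ _).trans (Finset.sum_le_sum fun g _ => ?_)
          refine (ContinuousLinearMap.le_opENorm _ _).trans_eq ?_
          rw [← ofReal_norm, hα, ofReal_norm]
      _ ≤ _ := ENNReal.sum_le_tsum _
  have hsq : ‖T ξ‖ₑ ^ 2 ≤ C * ENNReal.ofReal S * ‖ξ‖ₑ ^ 2 := by
    rw [← lp.tsum_enorm_sq (T ξ), ← lp.tsum_enorm_sq ξ, ← hf]
    exact (ENNReal.tsum_le_tsum fun h => pow_le_pow_left' (hpt h) 2).trans (hconv _ _)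
  have hreal : ‖T ξ‖ ^ 2 ≤ C.toReal * S * ‖ξ‖ ^ 2 := by
    simpa [ENNReal.toReal_mul, ENNReal.toReal_ofReal hS] using
      ENNReal.toReal_mono (by finiteness) hsq
  calc ‖T ξ‖ ≤ √C.toReal * √S * ‖ξ‖ := by
        rw [← sq_le_sq₀ (norm_nonneg _) (by positivity)]
        rwa [mul_pow, mul_pow, Real.sq_sqrt ENNReal.toReal_nonneg, Real.sq_sqrt hS]
    _ ≤ _ := by gcongr; linarith
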